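/- There exist constants C > 0 and μ ∈ (0,1) such that for every i ≥ 1 and for every pair of indices j, j' both belonging to {1,2,3,4,5,7} or both belonging to {6,8,9}, the angle in ℝ⁹ between the j-th and j'-th column vectors of the matrix Q_i = P_1·P_3·⋯·P_{2i+1} is at most C·μ^i; that is, the angles between column vectors within each of the two groups decay at least exponentially in i. -/

import Mathlib

open Filter Finset Matrix

/-- The golden ratio φ = (1+√5)/2. -/
noncomputable def goldphi : ℝ := (1 + Real.sqrt 5) / 2

/-- The matrix `A`: identity in rows 1–7, row 8 = (0,0,0,0,0,1,1,1,1),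
row 9 = (0,0,0,1,1,2,0,1,2). -/
def Amat : Matrix (Fin 9) (Fin 9) ℝ :=
  !![1,0,0,0,0,0,0,0,0;
     0,1,0,0,0,0,0,0,0;
     0,0,1,0,0,0,0,0,0;
     0,0,0,1,0,0,0,0,0;
     0,0,0,0,1,0,0,0,0;
     0,0,0,0,0,1,0,0,0;
     0,0,0,0,0,0,1,0,0;
     0,0,0,0,0,1,1,1,1;
     0,0,0,1,1,2,0,1,2]

/-- The matrix `M` with rows e₆, e₉, e₈, e₂, e₄+e₅, e₇, e₁+e₃, e₃, e₄. -/
def Mmat : Matrix (Fin 9) (Fin 9) ℝ :=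
  !![0,0,0,0,0,1,0,0,0;
     0,0,0,0,0,0,0,0,1;
     0,0,0,0,0,0,0,1,0;
     0,1,0,0,0,0,0,0,0;
     0,0,0,1,1,0,0,0,0;
     0,0,0,0,0,0,1,0,0;
     1,0,1,0,0,0,0,0,0;
     0,0,1,0,0,0,0,0,0;
     0,0,0,1,0,0,0,0,0]

/-- The rank-one limit matrix `L`, nonzero only in rows 2 and 3. -/
noncomputable def Lmat : Matrix (Fin 9) (Fin 9) ℝ :=
  !![0,0,0,0,0,0,0,0,0;
     (Real.sqrt 5 - 1)/4, 1/2, (1 + Real.sqrt 5)/4, (3 + Real.sqrt 5)/4, 1/2, 0, (3 + Real.sqrt 5)/4, 0, 0;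
     (3 - Real.sqrt 5)/4, (Real.sqrt 5 - 1)/4, 1/2, (1 + Real.sqrt 5)/4, (Real.sqrt 5 - 1)/4, 0, (1 + Real.sqrt 5)/4, 0, 0;
     0,0,0,0,0,0,0,0,0;
     0,0,0,0,0,0,0,0,0;
     0,0,0,0,0,0,0,0,0;
     0,0,0,0,0,0,0,0,0;
     0,0,0,0,0,0,0,0,0;
     0,0,0,0,0,0,0,0,0]

/-- `a_i = r_i - 1`. -/
def aseq (r : ℕ → ℕ) (i : ℕ) : ℕ := r i - 1

/-- `c_i = (2/√5)·φ^{2 a_i}`. -/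
noncomputable def cseq (r : ℕ → ℕ) (i : ℕ) : ℝ :=
  (2 / Real.sqrt 5) * goldphi ^ (2 * aseq r i)

/-- `P_i = A^{a_i} M A^{a_{i+1}} M`. -/
noncomputable def Pmat (r : ℕ → ℕ) (i : ℕ) : Matrix (Fin 9) (Fin 9) ℝ :=
  Amat ^ (aseq r i) * Mmat * Amat ^ (aseq r (i+1)) * Mmat

/-- `R_i = P_i / c_{i+1}`. -/
noncomputable def Rmat (r : ℕ → ℕ) (i : ℕ) : Matrix (Fin 9) (Fin 9) ℝ :=
  (cseq r (i+1))⁻¹ • Pmat r i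

/-- The Frobenius norm of a square real matrix. -/
noncomputable def frobNorm {n : ℕ} (X : Matrix (Fin n) (Fin n) ℝ) : ℝ :=
  Real.sqrt (∑ i, ∑ j, (X i j)^2)

/-- The hypotheses on the sequence `r`: `r 1 = 1`, `r 2 = 2`, and the sequence of
differences `n ↦ r (n+1) - r n` (for `n ≥ 1`) is strictly increasing. -/
def GoodSeq (r : ℕ → ℕ) : Prop :=
  r 1 = 1 ∧ r 2 = 2 ∧ ∀ n, 1 ≤ n → r (n+1) - r n < r (n+2) - r (n+1)

/-- The angle between two vectors of ℝ⁹ with respect to the standard inner product. -/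
noncomputable def vecAngle (u v : Fin 9 → ℝ) : ℝ :=
  Real.arccos ((∑ k, u k * v k) /
    (Real.sqrt (∑ k, (u k)^2) * Real.sqrt (∑ k, (v k)^2)))


/-- The pair `(F_{2a-1}, F_{2a})`. -/
def fibPair : ℕ → ℝ × ℝ
  | 0 => (1, 0)
  | n + 1 => ((fibPair n).1 + (fibPair n).2, (fibPair n).1 + 2 * (fibPair n).2)

def fX (a : ℕ) : ℝ := (fibPair a).1
def fY (a : ℕ) : ℝ := (fibPair a).2

lemma fX_succ (a : ℕ) : fX (a+1) = fX a + fY a := rfl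
lemma fY_succ (a : ℕ) : fY (a+1) = fX a + 2 * fY a := rfl
lemma fX_zero : fX 0 = 1 := rfl
lemma fY_zero : fY 0 = 0 := rfl

lemma vecMul_A (f : Fin 9 → ℝ) : f ᵥ* Amat =
    ![f 0, f 1, f 2, f 3 + f 8, f 4 + f 8, f 5 + f 7 + 2 * f 8, f 6 + f 7, f 7 + f 8,
      f 7 + 2 * f 8] := by
  ext j
  fin_cases j <;> simp [Matrix.vecMul, dotProduct, Fin.sum_univ_succ, Amat, Fin.succ] <;> ring

lemma vecMul_M (f : Fin 9 → ℝ) : f ᵥ* Mmat =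
    ![f 6, f 3, f 6 + f 7, f 4 + f 8, f 4, f 0, f 5, f 2, f 1] := by
  ext j
  fin_cases j <;> simp [Matrix.vecMul, dotProduct, Fin.sum_univ_succ, Mmat, Fin.succ]

lemma vecMul_Apow (a : ℕ) (f : Fin 9 → ℝ) : f ᵥ* (Amat ^ a) =
    ![f 0, f 1, f 2, f 3 + (fX a - 1) * f 7 + fY a * f 8, f 4 + (fX a - 1) * f 7 + fY a * f 8,
      f 5 + (fX a + fY a - 1) * f 7 + (fX a + 2 * fY a - 1) * f 8,
      f 6 + (fY a - fX a + 1) * f 7 + (fX a - 1) * f 8,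
      fX a * f 7 + fY a * f 8, fY a * f 7 + (fX a + fY a) * f 8] := by
  induction a with
  | zero =>
    ext j
    fin_cases j <;> simp [fX_zero, fY_zero]
  | succ a ih =>
    rw [pow_succ, ← Matrix.vecMul_vecMul, ih, vecMul_A]
    ext j
    fin_cases j <;> simp [fX_succ, fY_succ] <;> ring

/-- Explicit action of `P` on a row vector. -/
lemma vecMul_P (a b : ℕ) (f : Fin 9 → ℝ) :
    f ᵥ* (Amat ^ a * Mmat * Amat ^ b * Mmat) =
    ![f 5 + (fX a + fY a - 1) * f 7 + (fX a + 2 * fY a - 1) * f 8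
        + (fY b - fX b + 1) * f 2 + (fX b - 1) * f 1,
      f 4 + (fX a - 1) * f 7 + fY a * f 8 + (fY a * f 7 + (fX a + fY a) * f 8)
        + (fX b - 1) * f 2 + fY b * f 1,
      f 5 + (fX a + fY a - 1) * f 7 + (fX a + 2 * fY a - 1) * f 8
        + (fY b - fX b + 1) * f 2 + (fX b - 1) * f 1 + (fX b * f 2 + fY b * f 1),
      f 4 + (fX a - 1) * f 7 + fY a * f 8 + (fX b - 1) * f 2 + fY b * f 1
        + (fY b * f 2 + (fX b + fY b) * f 1),
      f 4 + (fX a - 1) * f 7 + fY a * f 8 + (fX b - 1) * f 2 + fY b * f 1,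
      f 6 + (fY a - fX a + 1) * f 7 + (fX a - 1) * f 8,
      f 0 + (fX b + fY b - 1) * f 2 + (fX b + 2 * fY b - 1) * f 1,
      f 6 + (fY a - fX a + 1) * f 7 + (fX a - 1) * f 8 + (fX a * f 7 + fY a * f 8),
      f 3 + (fX a - 1) * f 7 + fY a * f 8] := by
  rw [← Matrix.vecMul_vecMul, ← Matrix.vecMul_vecMul, ← Matrix.vecMul_vecMul, vecMul_Apow,
    vecMul_M, vecMul_Apow, vecMul_M]
  ext j
  fin_cases j <;> simp

lemma goldphi_sq : goldphi ^ 2 = goldphi + 1 := by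
  have h : Real.sqrt 5 ^ 2 = 5 := Real.sq_sqrt (by norm_num)
  unfold goldphi
  nlinarith

lemma goldphi_bounds : 3 / 2 ≤ goldphi ∧ goldphi ≤ 2 := by
  have h : Real.sqrt 5 ^ 2 = 5 := Real.sq_sqrt (by norm_num)
  have h0 : 0 ≤ Real.sqrt 5 := Real.sqrt_nonneg 5
  unfold goldphi
  constructor <;> nlinarith

lemma fib_bounds (a : ℕ) : 1 ≤ fX a ∧ 0 ≤ fY a ∧ fY a ≤ 2 * fX a ∧ fX a - 1 ≤ fY a := by
  induction a with
  | zero => simp [fX_zero, fY_zero]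
  | succ a ih =>
    obtain ⟨h1, h2, h3, h4⟩ := ih
    rw [fX_succ, fY_succ]
    refine ⟨?_, ?_, ?_, ?_⟩ <;> linarith

lemma fX_le_fY (a : ℕ) (ha : 1 ≤ a) : fX a ≤ fY a := by
  obtain ⟨b, rfl⟩ := Nat.exists_eq_add_of_le' ha
  obtain ⟨h1, h2, h3, h4⟩ := fib_bounds b
  rw [fX_succ, fY_succ]
  linarith

lemma fib_gamma (a : ℕ) : |fY a - goldphi * fX a| ≤ 2 := by
  induction a with
  | zero =>
    obtain ⟨h1, h2⟩ := goldphi_bounds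
    rw [fX_zero, fY_zero, abs_le]
    constructor <;> linarith
  | succ a ih =>
    obtain ⟨h1, h2⟩ := goldphi_bounds
    have e : fY (a+1) - goldphi * fX (a+1) = (2 - goldphi) * (fY a - goldphi * fX a) := by
      rw [fX_succ, fY_succ]
      linear_combination fX a * goldphi_sq * (-1)
    rw [e, abs_mul, abs_of_nonneg (by linarith : (0:ℝ) ≤ 2 - goldphi)]
    nlinarith [abs_nonneg (fY a - goldphi * fX a)]

lemma fX_grow (a m : ℕ) (ha : 1 ≤ a) : 2 ^ m * fX a ≤ fX (a + m) := by
  induction m with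
  | zero => simp
  | succ m ih =>
    have h := fX_le_fY (a + m) (by omega)
    rw [← add_assoc, fX_succ, pow_succ]
    linarith

lemma fX_mono_grow {a b m : ℕ} (ha : 1 ≤ a) (h : a + m ≤ b) : 2 ^ m * fX a ≤ fX b := by
  obtain ⟨k, rfl⟩ := Nat.exists_eq_add_of_le h
  refine (fX_grow a m ha).trans ?_
  have := fX_grow (a + m) k (by omega)
  have h1 : (1:ℝ) ≤ 2 ^ k := one_le_pow₀ (by norm_num)
  have := (fib_bounds (a+m)).1
  nlinarith

/-- Asymptotic coefficients of the columns. -/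
noncomputable def coefs : Fin 9 → ℝ :=
  ![goldphi - 1, 1, goldphi, 1 + goldphi, 1, goldphi - 1, 1 + goldphi, goldphi, 1]

lemma coefs_bounds (j : Fin 9) : 1 / 2 ≤ coefs j ∧ coefs j ≤ 3 := by
  obtain ⟨h1, h2⟩ := goldphi_bounds
  fin_cases j <;> simp only [coefs] <;> constructor <;> simp <;> linarith

lemma sum9 (f : Fin 9 → ℝ) :
    ∑ k, f k = f 0 + f 1 + f 2 + f 3 + f 4 + f 5 + f 6 + f 7 + f 8 := by
  simp [Fin.sum_univ_succ, Fin.succ]; ring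

lemma errU (a b : ℕ) (f : Fin 9 → ℝ) (hf : ∀ k, 0 ≤ f k) (j : Fin 9)
    (hj : j ∈ ({0,1,2,3,4,6} : Finset (Fin 9))) :
    |(f ᵥ* (Amat ^ a * Mmat * Amat ^ b * Mmat)) j - coefs j * fX b * (f 2 + goldphi * f 1)|
      ≤ 20 * fX a * ∑ k, f k := by
  rw [vecMul_P, sum9]
  obtain ⟨h1, h2, h3, h4⟩ := fib_bounds a
  have hg := abs_le.1 (fib_gamma b)
  obtain ⟨γ, hγ⟩ : ∃ γ, fY b = goldphi * fX b + γ := ⟨fY b - goldphi * fX b, by ring⟩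
  rw [hγ] at hg ⊢
  have hg1 : -2 ≤ γ := by linarith [hg.1]
  have hg2 : γ ≤ 2 := by linarith [hg.2]
  have p1 : ∀ k, f k ≤ fX a * f k := fun k => by nlinarith [hf k]
  have p2 : ∀ k, 0 ≤ fY a * f k := fun k => mul_nonneg h2 (hf k)
  have p3 : ∀ k, fY a * f k ≤ 2 * fX a * f k := fun k => by nlinarith [hf k]
  have p4 : ∀ k, -2 * f k ≤ γ * f k := fun k => by nlinarith [hf k]
  have p5 : ∀ k, γ * f k ≤ 2 * f k := fun k => by nlinarith [hf k]
  have sq := goldphi_sq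
  have e1 : goldphi ^ 2 * fX b * f 1 = (goldphi + 1) * fX b * f 1 := by rw [sq]
  generalize fX a = X at *
  generalize fY a = Y at *
  generalize fX b = X' at *
  rw [abs_le]
  simp only [Finset.mem_insert, Finset.mem_singleton] at hj
  rcases hj with rfl | rfl | rfl | rfl | rfl | rfl <;> simp [coefs] <;> constructor <;>
  linarith [hf 0, hf 1, hf 2, hf 3, hf 4, hf 5, hf 6, hf 7, hf 8, p1 0, p1 1, p1 2, p1 3, p1 4,
    p1 5, p1 6, p1 7, p1 8, p2 7, p2 8, p3 7, p3 8, p4 1, p4 2, p5 1, p5 2]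

lemma errW (a b : ℕ) (f : Fin 9 → ℝ) (hf : ∀ k, 0 ≤ f k) (j : Fin 9)
    (hj : j ∈ ({5,7,8} : Finset (Fin 9))) :
    |(f ᵥ* (Amat ^ a * Mmat * Amat ^ b * Mmat)) j - coefs j * fX a * (f 7 + goldphi * f 8)|
      ≤ (f 3 + f 6) + 5 * (f 7 + f 8) := by
  rw [vecMul_P]
  have hg := abs_le.1 (fib_gamma a)
  obtain ⟨γ, hγ⟩ : ∃ γ, fY a = goldphi * fX a + γ := ⟨fY a - goldphi * fX a, by ring⟩
  rw [hγ] at hg ⊢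
  have hg1 : -2 ≤ γ := by linarith [hg.1]
  have hg2 : γ ≤ 2 := by linarith [hg.2]
  have p4 : ∀ k, -2 * f k ≤ γ * f k := fun k => by nlinarith [hf k]
  have p5 : ∀ k, γ * f k ≤ 2 * f k := fun k => by nlinarith [hf k]
  have sq := goldphi_sq
  have e1 : goldphi ^ 2 * fX a * f 8 = (goldphi + 1) * fX a * f 8 := by rw [sq]
  generalize fX a = X at *
  rw [abs_le]
  simp only [Finset.mem_insert, Finset.mem_singleton] at hj
  rcases hj with rfl | rfl | rfl <;> simp [coefs] <;> constructor <;>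
  linarith [hf 3, hf 6, hf 7, hf 8, p4 7, p4 8, p5 7, p5 8]

lemma P_upper (a b : ℕ) (f : Fin 9 → ℝ) (hf : ∀ k, 0 ≤ f k) (j : Fin 9) :
    (f ᵥ* (Amat ^ a * Mmat * Amat ^ b * Mmat)) j ≤
      10 * fX b * (f 1 + f 2) + 20 * fX a * ∑ k, f k := by
  obtain ⟨c1, c2⟩ := coefs_bounds j
  obtain ⟨g1, g2⟩ := goldphi_bounds
  have hX := (fib_bounds a).1
  have hX' := (fib_bounds b).1
  by_cases hj : j ∈ ({0,1,2,3,4,6} : Finset (Fin 9))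
  · have h := (abs_le.1 (errU a b f hf j hj)).2
    have h2 : f 2 + goldphi * f 1 ≤ 2 * (f 1 + f 2) := by nlinarith [hf 1, hf 2]
    have h3 : coefs j * fX b ≤ 3 * fX b := by nlinarith
    have h4 : coefs j * fX b * (f 2 + goldphi * f 1) ≤ 3 * fX b * (2 * (f 1 + f 2)) :=
      mul_le_mul h3 h2 (by nlinarith [hf 1, hf 2]) (by linarith)
    nlinarith [mul_nonneg (by linarith : 0 ≤ fX b) (add_nonneg (hf 1) (hf 2))]
  · have hj' : j ∈ ({5,7,8} : Finset (Fin 9)) := by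
      clear c1 c2
      revert hj; revert j; decide
    have h := (abs_le.1 (errW a b f hf j hj')).2
    have h2 : f 7 + goldphi * f 8 ≤ 2 * (f 7 + f 8) := by nlinarith [hf 7, hf 8]
    have h3 : coefs j * fX a ≤ 3 * fX a := by nlinarith
    have h4 : coefs j * fX a * (f 7 + goldphi * f 8) ≤ 3 * fX a * (2 * (f 7 + f 8)) :=
      mul_le_mul h3 h2 (by nlinarith [hf 7, hf 8]) (by linarith)
    have h5 := mul_nonneg (by linarith : 0 ≤ fX b) (add_nonneg (hf 1) (hf 2))
    have p1 : ∀ k, f k ≤ fX a * f k := fun k => by nlinarith [hf k]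
    rw [sum9]
    linarith [hf 0, hf 1, hf 2, hf 3, hf 4, hf 5, hf 6, hf 7, hf 8, p1 0, p1 1, p1 2, p1 3, p1 4,
      p1 5, p1 6, p1 7, p1 8]

lemma P_pos (a b : ℕ) (f : Fin 9 → ℝ) (hf : ∀ k, 0 < f k) (j : Fin 9) :
    0 < (f ᵥ* (Amat ^ a * Mmat * Amat ^ b * Mmat)) j := by
  rw [vecMul_P]
  obtain ⟨h1, h2, h3, h4⟩ := fib_bounds a
  obtain ⟨k1, k2, k3, k4⟩ := fib_bounds b
  have q1 : ∀ k, 0 ≤ (fX a - 1) * f k := fun k => mul_nonneg (by linarith) (hf k).le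
  have q2 : ∀ k, 0 ≤ fY a * f k := fun k => mul_nonneg (by linarith) (hf k).le
  have q3 : ∀ k, 0 ≤ (fY a - fX a + 1) * f k := fun k => mul_nonneg (by linarith) (hf k).le
  have r1 : ∀ k, 0 ≤ (fX b - 1) * f k := fun k => mul_nonneg (by linarith) (hf k).le
  have r2 : ∀ k, 0 ≤ fY b * f k := fun k => mul_nonneg (by linarith) (hf k).le
  have r3 : ∀ k, 0 ≤ (fY b - fX b + 1) * f k := fun k => mul_nonneg (by linarith) (hf k).le
  fin_cases j <;> simp <;>
  linarith [hf 0, hf 1, hf 2, hf 3, hf 4, hf 5, hf 6, hf 7, hf 8, q1 7, q1 8, q2 7, q2 8, q3 7,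
    r1 1, r1 2, r2 1, r2 2, r3 2]

lemma P_nonneg (a b : ℕ) (f : Fin 9 → ℝ) (hf : ∀ k, 0 ≤ f k) (j : Fin 9) :
    0 ≤ (f ᵥ* (Amat ^ a * Mmat * Amat ^ b * Mmat)) j := by
  rw [vecMul_P]
  obtain ⟨h1, h2, h3, h4⟩ := fib_bounds a
  obtain ⟨k1, k2, k3, k4⟩ := fib_bounds b
  have q1 : ∀ k, 0 ≤ (fX a - 1) * f k := fun k => mul_nonneg (by linarith) (hf k)
  have q2 : ∀ k, 0 ≤ fY a * f k := fun k => mul_nonneg (by linarith) (hf k)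
  have q3 : ∀ k, 0 ≤ (fY a - fX a + 1) * f k := fun k => mul_nonneg (by linarith) (hf k)
  have r1 : ∀ k, 0 ≤ (fX b - 1) * f k := fun k => mul_nonneg (by linarith) (hf k)
  have r2 : ∀ k, 0 ≤ fY b * f k := fun k => mul_nonneg (by linarith) (hf k)
  have r3 : ∀ k, 0 ≤ (fY b - fX b + 1) * f k := fun k => mul_nonneg (by linarith) (hf k)
  fin_cases j <;> simp <;>
  linarith [hf 0, hf 1, hf 2, hf 3, hf 4, hf 5, hf 6, hf 7, hf 8, q1 7, q1 8, q2 7, q2 8, q3 7,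
    r1 1, r1 2, r2 1, r2 2, r3 2]

lemma P_lowU (a b : ℕ) (hb : 2 ≤ fX b) (hb1 : 1 ≤ b) (f : Fin 9 → ℝ) (hf : ∀ k, 0 ≤ f k) :
    fX b / 2 * (f 1 + f 2) ≤ (f ᵥ* (Amat ^ a * Mmat * Amat ^ b * Mmat)) 1 := by
  rw [vecMul_P]
  obtain ⟨h1, h2, h3, h4⟩ := fib_bounds a
  have k := fX_le_fY b hb1
  have q1 : ∀ k, 0 ≤ (fX a - 1) * f k := fun k => mul_nonneg (by linarith) (hf k)
  have q2 : ∀ k, 0 ≤ fY a * f k := fun k => mul_nonneg (by linarith) (hf k)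
  have r1 : fX b / 2 * f 2 ≤ (fX b - 1) * f 2 := by nlinarith [hf 2]
  have r2 : fX b / 2 * f 1 ≤ fY b * f 1 := by nlinarith [hf 1]
  simp
  linarith [hf 4, hf 7, hf 8, q1 7, q1 8, q2 7, q2 8]

lemma P_lowW (a b : ℕ) (ha : 1 ≤ a) (f : Fin 9 → ℝ) (hf : ∀ k, 0 ≤ f k) :
    fX a * (f 7 + f 8) ≤ (f ᵥ* (Amat ^ a * Mmat * Amat ^ b * Mmat)) 7 := by
  rw [vecMul_P]
  obtain ⟨h1, h2, h3, h4⟩ := fib_bounds a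
  have k := fX_le_fY a ha
  have q1 : ∀ k, 0 ≤ (fX a - 1) * f k := fun k => mul_nonneg (by linarith) (hf k)
  have q3 : ∀ k, 0 ≤ (fY a - fX a + 1) * f k := fun k => mul_nonneg (by linarith) (hf k)
  have r2 : fX a * f 8 ≤ fY a * f 8 := by nlinarith [hf 8]
  simp
  linarith [hf 6, q1 8, q3 7]

lemma inner_ratio {F : Type*} [NormedAddCommGroup F] [InnerProductSpace ℝ F]
    (u u' v : F) (α α' δ : ℝ) (hα : 0 < α) (hα' : 0 < α') (hv : 0 < ‖v‖)
    (he : ‖u - α • v‖ ≤ δ * (α * ‖v‖)) (he' : ‖u' - α' • v‖ ≤ δ * (α' * ‖v‖)) :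
    1 - 8 * δ ≤ inner ℝ u u' / (‖u‖ * ‖u'‖) := by
  have hδ : 0 ≤ δ := by
    by_contra h
    push Not at h
    have := norm_nonneg (u - α • v)
    nlinarith [mul_pos hα hv]
  by_cases hd : 1 / 4 ≤ δ
  · have := (abs_le.1 (abs_real_inner_div_norm_mul_norm_le_one u u')).1
    linarith
  push Not at hd
  obtain ⟨e, he0⟩ : ∃ e, e = u - α • v := ⟨_, rfl⟩
  obtain ⟨e', he0'⟩ : ∃ e', e' = u' - α' • v := ⟨_, rfl⟩
  rw [← he0] at he
  rw [← he0'] at he'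
  have hu : u = α • v + e := by rw [he0]; abel
  have hu' : u' = α' • v + e' := by rw [he0']; abel
  have n1 : ‖α • v‖ = α * ‖v‖ := by rw [norm_smul, Real.norm_of_nonneg hα.le]
  have n1' : ‖α' • v‖ = α' * ‖v‖ := by rw [norm_smul, Real.norm_of_nonneg hα'.le]
  set p := α * ‖v‖ with hp
  set p' := α' * ‖v‖ with hp'
  have pp : 0 < p := mul_pos hα hv
  have pp' : 0 < p' := mul_pos hα' hv
  have up : ‖u‖ ≤ (1 + δ) * p := by
    rw [hu]; refine (norm_add_le _ _).trans ?_; rw [n1]; linarith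
  have up' : ‖u'‖ ≤ (1 + δ) * p' := by
    rw [hu']; refine (norm_add_le _ _).trans ?_; rw [n1']; linarith
  have lo : 0 < ‖u‖ := by
    have := norm_sub_norm_le (α • v) (-e)
    rw [sub_neg_eq_add, ← hu, n1, norm_neg] at this
    nlinarith
  have lo' : 0 < ‖u'‖ := by
    have := norm_sub_norm_le (α' • v) (-e')
    rw [sub_neg_eq_add, ← hu', n1', norm_neg] at this
    nlinarith
  rw [le_div_iff₀ (mul_pos lo lo')]
  have i0 : inner ℝ (α • v) (α' • v) = p * p' := by
    rw [inner_smul_left, inner_smul_right, real_inner_self_eq_norm_sq, hp, hp']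
    simp; ring
  have i1 : -(p * (δ * p')) ≤ inner ℝ (α • v) e' := by
    have := (abs_le.1 (abs_real_inner_le_norm (α • v) e')).1
    rw [n1] at this
    nlinarith
  have i2 : -(δ * p * p') ≤ inner ℝ e (α' • v) := by
    have := (abs_le.1 (abs_real_inner_le_norm e (α' • v))).1
    rw [n1'] at this
    nlinarith
  have i3 : -(δ * p * (δ * p')) ≤ inner ℝ e e' := by
    have := (abs_le.1 (abs_real_inner_le_norm e e')).1
    have := mul_le_mul he he' (norm_nonneg _) (by positivity)
    linarith
  have I : (1 - 2 * δ - δ ^ 2) * (p * p') ≤ inner ℝ u u' := by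
    rw [hu, hu', inner_add_left, inner_add_right, inner_add_right, i0]
    nlinarith
  have N : ‖u‖ * ‖u'‖ ≤ (1 + δ) ^ 2 * (p * p') := by
    have := mul_le_mul up up' (norm_nonneg _) (by positivity)
    nlinarith
  have s1 : (1 - 8 * δ) * (‖u‖ * ‖u'‖) ≤ (1 - 4 * δ) * (‖u‖ * ‖u'‖) :=
    mul_le_mul_of_nonneg_right (by linarith) (by positivity)
  have s2 : (1 - 4 * δ) * (‖u‖ * ‖u'‖) ≤ (1 - 4 * δ) * ((1 + δ) ^ 2 * (p * p')) :=
    mul_le_mul_of_nonneg_left N (by linarith)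
  have s3 : (1 - 4 * δ) * (1 + δ) ^ 2 ≤ 1 - 2 * δ - δ ^ 2 := by
    nlinarith [pow_nonneg hδ 2, pow_nonneg hδ 3]
  have s4 := mul_le_mul_of_nonneg_right s3 (mul_pos pp pp').le
  linarith

lemma arccos_sq_le (c ε : ℝ) (hc : 1 - ε ≤ c) (h1 : -1 ≤ c) (h2 : c ≤ 1) :
    Real.arccos c ^ 2 ≤ 5 * ε := by
  have h0 := Real.arccos_nonneg c
  have hpi := Real.arccos_le_pi c
  have h := Real.cos_le_one_sub_mul_cos_sq (x := Real.arccos c)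
    (by rw [abs_of_nonneg h0]; exact hpi)
  rw [Real.cos_arccos h1 h2] at h
  have pi2 : Real.pi ^ 2 ≤ 10 := by nlinarith [Real.pi_lt_d2, Real.pi_pos]
  have pp : 0 < Real.pi ^ 2 := by positivity
  have hh : 2 / Real.pi ^ 2 * Real.arccos c ^ 2 ≤ ε := by linarith
  rw [div_mul_eq_mul_div, div_le_iff₀ pp] at hh
  have : 0 ≤ ε := by linarith
  nlinarith

lemma vecAngle_sq_le (u u' v : Fin 9 → ℝ) (α α' δ : ℝ) (hα : 0 < α) (hα' : 0 < α')
    (hv0 : 0 < ∑ k, v k)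
    (he : ∑ k, |u k - α * v k| ≤ δ * (α * ∑ k, v k))
    (he' : ∑ k, |u' k - α' * v k| ≤ δ * (α' * ∑ k, v k)) :
    vecAngle u u' ^ 2 ≤ 120 * δ := by
  have hδ : 0 ≤ δ := by
    by_contra h
    push Not at h
    have : 0 ≤ ∑ k, |u k - α * v k| := Finset.sum_nonneg fun _ _ => abs_nonneg _
    nlinarith [mul_pos hα hv0]
  let L : (Fin 9 → ℝ) → EuclideanSpace ℝ (Fin 9) := fun w => WithLp.toLp 2 w
  have nrm : ∀ w, ‖L w‖ = Real.sqrt (∑ k, (w k) ^ 2) := fun w => by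
    simp [L, EuclideanSpace.norm_eq]
  have n1 : ∀ w, ‖L w‖ ≤ ∑ k, |w k| := fun w => by
    rw [nrm]
    refine Real.sqrt_le_iff.2 ⟨Finset.sum_nonneg fun _ _ => abs_nonneg _, ?_⟩
    have := Finset.sum_sq_le_sq_sum_of_nonneg (s := Finset.univ) (f := fun k => |w k|)
      (fun _ _ => abs_nonneg _)
    simpa using this
  have n2 : ∑ k, v k ≤ 3 * ‖L v‖ := by
    rw [nrm]
    have := sq_sum_le_card_mul_sum_sq (s := Finset.univ) (f := v)
    simp at this
    have h0 : 0 ≤ ∑ k, (v k) ^ 2 := Finset.sum_nonneg fun _ _ => sq_nonneg _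
    have h1 := Real.sq_sqrt h0
    refine abs_le_of_sq_le_sq' ?_ (by positivity) |>.2
    nlinarith
  have hLv : 0 < ‖L v‖ := by linarith
  have E1 : ‖L u - α • L v‖ ≤ 3 * δ * (α * ‖L v‖) := by
    have : L u - α • L v = L (fun k => u k - α * v k) := by
      ext k; simp [L]
    rw [this]
    refine (n1 _).trans (he.trans ?_)
    have := mul_le_mul_of_nonneg_left n2 (mul_nonneg hδ hα.le)
    nlinarith
  have E2 : ‖L u' - α' • L v‖ ≤ 3 * δ * (α' * ‖L v‖) := by
    have : L u' - α' • L v = L (fun k => u' k - α' * v k) := by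
      ext k; simp [L]
    rw [this]
    refine (n1 _).trans (he'.trans ?_)
    have := mul_le_mul_of_nonneg_left n2 (mul_nonneg hδ hα'.le)
    nlinarith
  have R := inner_ratio (L u) (L u') (L v) α α' (3 * δ) hα hα' hLv E1 E2
  have B := abs_le.1 (abs_real_inner_div_norm_mul_norm_le_one (L u) (L u'))
  have I : inner ℝ (L u) (L u') = ∑ k, u k * u' k := by
    simp [L, PiLp.inner_apply, mul_comm]
  rw [I, nrm, nrm] at R B
  have := arccos_sq_le _ (8 * (3 * δ)) R B.1 B.2
  unfold vecAngle
  linarith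

lemma seq_bounds (S W T x x' : ℕ → ℝ) (hSp : ∀ n, 0 < S n) (hWp : ∀ n, 0 < W n)
    (hST : ∀ n, S n ≤ T n)
    (hT : ∀ n, T (n+1) ≤ 90 * x' n * S n + 180 * x n * T n)
    (hS : ∀ n, x' n / 2 * S n ≤ S (n+1))
    (hW : ∀ n, x n * W n ≤ W (n+1))
    (hx : ∀ n, 2 ^ n * x n ≤ x' n) (hx' : ∀ n, 2 ^ n * x' n ≤ x (n+1)) (hx1 : ∀ n, 1 ≤ x n) :
    ∃ (N : ℕ) (K D : ℝ), 0 < K ∧ 0 < D ∧ ∀ n, N ≤ n →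
      T n ≤ K * S n ∧ S n ≤ D * (1/2) ^ n * (x n * W n) := by
  have hTp : ∀ n, 0 < T n := fun n => (hSp n).trans_le (hST n)
  have hxp : ∀ n, 0 < x n := fun n => by linarith [hx1 n]
  have hxx : ∀ n, x n ≤ x' n := fun n => by
    have : (1:ℝ) ≤ 2 ^ n := one_le_pow₀ (by norm_num)
    nlinarith [hx n, hxp n]
  have hxp' : ∀ n, 0 < x' n := fun n => (hxp n).trans_le (hxx n)
  obtain ⟨K, hK1, hK2⟩ : ∃ K : ℝ, 1000 ≤ K ∧ T 10 ≤ K * S 10 := by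
    refine ⟨max 1000 (T 10 / S 10), le_max_left _ _, ?_⟩
    rw [← div_le_iff₀ (hSp 10)]
    exact le_max_right _ _
  have A : ∀ n, 10 ≤ n → T n ≤ K * S n := by
    intro n hn
    induction n, hn using Nat.le_induction with
    | base => exact hK2
    | succ n hn ih =>
      have h1 : (1024:ℝ) ≤ 2 ^ n := by
        calc (1024:ℝ) = 2 ^ 10 := by norm_num
          _ ≤ 2 ^ n := pow_le_pow_right₀ (by norm_num) hn
      have h2 : 1024 * x n ≤ x' n := by nlinarith [hx n, hxp n]
      have h3 : x n * T n ≤ x n * (K * S n) := mul_le_mul_of_nonneg_left ih (hxp n).le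
      have hKS : 0 < K * S n := mul_pos (by linarith) (hSp n)
      have h4 : 1024 * x n * (K * S n) ≤ x' n * (K * S n) :=
        mul_le_mul_of_nonneg_right h2 hKS.le
      have h5 : 1000 * (x' n * S n) ≤ K * (x' n * S n) :=
        mul_le_mul_of_nonneg_right hK1 (mul_pos (hxp' n) (hSp n)).le
      have h6 : K * (x' n / 2 * S n) ≤ K * S (n+1) :=
        mul_le_mul_of_nonneg_left (hS n) (by linarith)
      have h7 := hT n
      nlinarith [mul_pos (hxp' n) (hSp n)]
  obtain ⟨K3, hK3⟩ : ∃ K3 : ℝ, K3 = 90 + 180 * K := ⟨_, rfl⟩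
  have hK3p : 0 < K3 := by linarith
  have B : ∀ n, 10 ≤ n → S (n+1) ≤ K3 * (x' n * S n) := by
    intro n hn
    have h0 := A n hn
    have h3 : x n * T n ≤ x' n * (K * S n) :=
      mul_le_mul (hxx n) h0 (hTp n).le (hxp' n).le
    have := hT n
    have := hST (n+1)
    rw [hK3]
    nlinarith
  obtain ⟨m, hm⟩ := pow_unbounded_of_one_lt (2 * K3) (by norm_num : (1:ℝ) < 2)
  obtain ⟨N, hN1, hN2⟩ : ∃ N, 10 ≤ N ∧ m ≤ N := ⟨max 10 m, le_max_left _ _, le_max_right _ _⟩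
  obtain ⟨D, hD1, hD2⟩ : ∃ D : ℝ, 0 < D ∧ S N ≤ D * (1/2) ^ N * (x N * W N) := by
    have hp : 0 < (1/2:ℝ) ^ N * (x N * W N) :=
      mul_pos (by positivity) (mul_pos (hxp N) (hWp N))
    refine ⟨S N / ((1/2) ^ N * (x N * W N)), div_pos (hSp N) hp, ?_⟩
    rw [mul_assoc, div_mul_cancel₀ _ hp.ne']
  refine ⟨N, K, D, by linarith, hD1, fun n hn => ⟨A n (hN1.trans hn), ?_⟩⟩
  induction n, hn using Nat.le_induction with
  | base => exact hD2
  | succ n hn ih =>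
    have h2 : 2 * K3 ≤ 2 ^ n := hm.le.trans (pow_le_pow_right₀ (by norm_num) (hN2.trans hn))
    have hDn : 0 < D * (1/2:ℝ) ^ n := by positivity
    have b1 := B n (hN1.trans hn)
    have b2 : K3 * (x' n * S n) ≤ K3 * (x' n * (D * (1/2) ^ n * (x n * W n))) := by
      have := hxp' n
      gcongr
    have b3 : K3 * (x' n * (D * (1/2) ^ n * (x n * W n)))
        ≤ K3 * (x' n * (D * (1/2) ^ n * W (n+1))) := by
      have := hxp' n
      have := hW n
      gcongr
    have b4 : 2 * K3 * x' n ≤ x (n+1) :=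
      (mul_le_mul_of_nonneg_right h2 (hxp' n).le).trans (hx' n)
    have b5 : 2 * K3 * x' n * (D * (1/2) ^ n * W (n+1)) ≤ x (n+1) * (D * (1/2) ^ n * W (n+1)) :=
      mul_le_mul_of_nonneg_right b4 (mul_pos hDn (hWp _)).le
    rw [pow_succ]
    nlinarith

lemma aseq_step (r : ℕ → ℕ) (hr : GoodSeq r) (n : ℕ) (hn : 1 ≤ n) :
    1 ≤ r n ∧ r n + n ≤ r (n+1) := by
  obtain ⟨h1, h2, h3⟩ := hr
  have d : ∀ n, 1 ≤ n → n ≤ r (n+1) - r n := by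
    intro n hn
    induction n, hn using Nat.le_induction with
    | base => simp [h1, h2]
    | succ n hn ih =>
      have : r (n+1) - r n < r (n+1+1) - r (n+1) := h3 n hn
      omega
  have p : 1 ≤ r n := by
    induction n, hn using Nat.le_induction with
    | base => simp [h1]
    | succ n hn ih => have := d n hn; omega
  have := d n hn
  omega

lemma aseq_facts (r : ℕ → ℕ) (hr : GoodSeq r) (n : ℕ) (hn : 1 ≤ n) :
    n ≤ aseq r n + 1 ∧ aseq r n + n ≤ aseq r (n+1) := by
  have st : ∀ n, 1 ≤ n → aseq r n + n ≤ aseq r (n+1) := fun n hn => by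
    have := aseq_step r hr n hn
    unfold aseq; omega
  refine ⟨?_, st n hn⟩
  induction n, hn using Nat.le_induction with
  | base => omega
  | succ n hn ih => have := st n hn; omega

/-- The partial products. -/
noncomputable def Qm (r : ℕ → ℕ) (i : ℕ) : Matrix (Fin 9) (Fin 9) ℝ :=
  ((List.range (i+1)).map (fun l => Pmat r (2*l+1))).prod

lemma Qm_succ (r : ℕ → ℕ) (n : ℕ) : Qm r (n+1) = Qm r n *
    (Amat ^ (aseq r (2*n+3)) * Mmat * Amat ^ (aseq r (2*n+4)) * Mmat) := by
  unfold Qm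
  rw [List.range_succ, List.map_append, List.prod_append]
  simp [Pmat, mul_add]

lemma Qm_row (r : ℕ → ℕ) (n : ℕ) (k j : Fin 9) : Qm r (n+1) k j =
    ((fun m => Qm r n k m) ᵥ*
      (Amat ^ (aseq r (2*n+3)) * Mmat * Amat ^ (aseq r (2*n+4)) * Mmat)) j := by
  rw [Qm_succ]; rfl

lemma Qm_zero_row (r : ℕ → ℕ) (k j : Fin 9) : Qm r 0 k j =
    ((fun m => (1 : Matrix (Fin 9) (Fin 9) ℝ) k m) ᵥ*
      (Amat ^ (aseq r 1) * Mmat * Amat ^ (aseq r 2) * Mmat)) j := by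
  have : Qm r 0 = 1 * (Amat ^ (aseq r 1) * Mmat * Amat ^ (aseq r 2) * Mmat) := by
    simp [Qm, Pmat]
  rw [this]; rfl

lemma Qm_nonneg (r : ℕ → ℕ) (n : ℕ) (k j : Fin 9) : 0 ≤ Qm r n k j := by
  induction n generalizing j with
  | zero =>
    rw [Qm_zero_row]
    refine P_nonneg _ _ _ (fun m => ?_) j
    rw [Matrix.one_apply]; split_ifs <;> norm_num
  | succ n ih =>
    rw [Qm_row]
    exact P_nonneg _ _ _ (fun m => ih m) j

/-- Column sums. -/
noncomputable def cs (r : ℕ → ℕ) (n : ℕ) (j : Fin 9) : ℝ := ∑ k, Qm r n k j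

lemma sum_vecMul (Q P : Matrix (Fin 9) (Fin 9) ℝ) (j : Fin 9) :
    ∑ k, (Q * P) k j = ((fun m => ∑ k, Q k m) ᵥ* P) j := by
  simp only [Matrix.mul_apply, Matrix.vecMul, dotProduct, Finset.sum_mul]
  exact Finset.sum_comm

lemma cs_succ (r : ℕ → ℕ) (n : ℕ) (j : Fin 9) : cs r (n+1) j = (cs r n ᵥ*
      (Amat ^ (aseq r (2*n+3)) * Mmat * Amat ^ (aseq r (2*n+4)) * Mmat)) j := by
  have := sum_vecMul (Qm r n)
    (Amat ^ (aseq r (2*n+3)) * Mmat * Amat ^ (aseq r (2*n+4)) * Mmat) j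
  unfold cs
  rw [Qm_succ, this]

lemma cs_pos (r : ℕ → ℕ) (n : ℕ) (j : Fin 9) : 0 < cs r n j := by
  induction n generalizing j with
  | zero =>
    have h : Qm r 0 = 1 * (Amat ^ (aseq r 1) * Mmat * Amat ^ (aseq r 2) * Mmat) := by
      simp [Qm, Pmat]
    unfold cs
    rw [h, sum_vecMul]
    refine P_pos _ _ _ (fun m => ?_) j
    simp [Matrix.one_apply]
  | succ n ih =>
    rw [cs_succ]
    exact P_pos _ _ _ ih j

lemma angle_sq_decay (r : ℕ → ℕ) (hr : GoodSeq r) :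
    ∃ (N : ℕ) (D : ℝ), 0 < D ∧ ∀ n, N ≤ n → ∀ j j' : Fin 9,
        ((j ∈ ({0,1,2,3,4,6} : Finset (Fin 9)) ∧ j' ∈ ({0,1,2,3,4,6} : Finset (Fin 9))) ∨
         (j ∈ ({5,7,8} : Finset (Fin 9)) ∧ j' ∈ ({5,7,8} : Finset (Fin 9)))) →
        vecAngle (fun k => Qm r (n+1) k j) (fun k => Qm r (n+1) k j') ^ 2 ≤ D * (1/2) ^ n := by
  obtain ⟨x, hxd⟩ : ∃ x : ℕ → ℝ, ∀ n, x n = fX (aseq r (2*n+3)) := ⟨_, fun _ => rfl⟩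
  obtain ⟨x', hxd'⟩ : ∃ x : ℕ → ℝ, ∀ n, x n = fX (aseq r (2*n+4)) := ⟨_, fun _ => rfl⟩
  have a1 : ∀ n, 2 * n + 2 ≤ aseq r (2*n+3) := fun n => by
    have := (aseq_facts r hr (2*n+3) (by omega)).1; omega
  have a2 : ∀ n, aseq r (2*n+3) + n ≤ aseq r (2*n+4) := fun n => by
    have : aseq r (2*n+3) + (2*n+3) ≤ aseq r (2*n+4) := (aseq_facts r hr (2*n+3) (by omega)).2; omega
  have a3 : ∀ n, aseq r (2*n+4) + n ≤ aseq r (2*(n+1)+3) := fun n => by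
    have := (aseq_facts r hr (2*n+4) (by omega)).2
    have e : 2 * (n+1) + 3 = 2*n+4+1 := by ring
    rw [e]; omega
  have hx : ∀ n, 2 ^ n * x n ≤ x' n := fun n => by
    rw [hxd, hxd']; exact fX_mono_grow (by have := a1 n; omega) (a2 n)
  have hx' : ∀ n, 2 ^ n * x' n ≤ x (n+1) := fun n => by
    rw [hxd, hxd']; exact fX_mono_grow (by have := a1 n; have := a2 n; omega) (a3 n)
  have f1 : fX 1 = 1 := by rw [fX_succ, fX_zero, fY_zero]; norm_num
  have hx2 : ∀ n, 2 ^ n ≤ x n := fun n => by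
    have := fX_mono_grow (a := 1) (b := aseq r (2*n+3)) (m := n) le_rfl
      (by have := a1 n; omega)
    rw [f1, mul_one] at this
    rw [hxd]; exact this
  have hx1 : ∀ n, 1 ≤ x n := fun n => by rw [hxd]; exact (fib_bounds _).1
  have hx1' : ∀ n, 1 ≤ x' n := fun n => by rw [hxd']; exact (fib_bounds _).1
  have hx2' : ∀ n, 2 ≤ fX (aseq r (2*n+4)) := fun n => by
    have := fX_mono_grow (a := 1) (b := aseq r (2*n+4)) (m := 1) le_rfl
      (by have := a1 n; have := a2 n; omega)
    rw [f1] at this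
    linarith
  have pos := cs_pos r
  have nn : ∀ n k, 0 ≤ cs r n k := fun n k => (pos n k).le
  obtain ⟨N, K, D, hK, hD, H⟩ := seq_bounds (fun n => cs r n 1 + cs r n 2)
    (fun n => cs r n 7 + cs r n 8) (fun n => ∑ k, cs r n k) x x'
    (fun n => add_pos (pos n 1) (pos n 2)) (fun n => add_pos (pos n 7) (pos n 8))
    (fun n => by
      simp only [sum9]
      linarith [nn n 0, nn n 1, nn n 2, nn n 3, nn n 4, nn n 5, nn n 6, nn n 7, nn n 8])
    (fun n => by
      have : ∀ j ∈ (Finset.univ : Finset (Fin 9)), cs r (n+1) j ≤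
          10 * x' n * (cs r n 1 + cs r n 2) + 20 * x n * ∑ k, cs r n k := fun j _ => by
        rw [cs_succ, hxd, hxd']
        exact P_upper _ _ _ (nn n) j
      have := Finset.sum_le_card_nsmul _ _ _ this
      simp at this
      simp
      linarith)
    (fun n => by
      have := P_lowU (aseq r (2*n+3)) (aseq r (2*n+4)) (hx2' n)
        (by have := a1 n; have := a2 n; omega) (cs r n) (nn n)
      rw [← cs_succ, ← hxd'] at this
      linarith [nn (n+1) 2])
    (fun n => by
      have := P_lowW (aseq r (2*n+3)) (aseq r (2*n+4))
        (by have := a1 n; omega) (cs r n) (nn n)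
      rw [← cs_succ, ← hxd] at this
      linarith [nn (n+1) 8])
    hx hx' hx1
  refine ⟨N, 120 * (40 * K + 2 * (K * D + 5)), by positivity, fun n hn j j' hjj => ?_⟩
  obtain ⟨H1, H2⟩ := H n hn
  obtain ⟨g1, g2⟩ := goldphi_bounds
  have hpn : (0:ℝ) < (1/2) ^ n := by positivity
  have hpn2 : (1/2:ℝ) ^ n * 2 ^ n = 1 := by rw [← mul_pow]; norm_num
  have xp : 0 < x n := by linarith [hx1 n]
  have xp' : 0 < x' n := by linarith [hx1' n]
  have Sp : 0 < cs r n 1 + cs r n 2 := add_pos (pos n 1) (pos n 2)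
  have Wp : 0 < cs r n 7 + cs r n 8 := add_pos (pos n 7) (pos n 8)
  have key : ∀ δ, δ ≤ (40 * K + 2 * (K * D + 5)) * (1/2) ^ n →
      120 * δ ≤ 120 * (40 * K + 2 * (K * D + 5)) * (1/2) ^ n := fun δ h => by linarith
  rcases hjj with ⟨hj, hj'⟩ | ⟨hj, hj'⟩
  · have sv : ∑ k, (Qm r n k 2 + goldphi * Qm r n k 1) = cs r n 2 + goldphi * cs r n 1 := by
      rw [Finset.sum_add_distrib, ← Finset.mul_sum]; rfl
    have svl : cs r n 1 + cs r n 2 ≤ cs r n 2 + goldphi * cs r n 1 := by nlinarith [nn n 1]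
    have main : ∀ j ∈ ({0,1,2,3,4,6} : Finset (Fin 9)),
        ∑ k, |Qm r (n+1) k j - coefs j * x' n * (Qm r n k 2 + goldphi * Qm r n k 1)| ≤
        40 * K * (1/2) ^ n *
          (coefs j * x' n * ∑ k, (Qm r n k 2 + goldphi * Qm r n k 1)) := by
      intro j hj
      have e1 : ∑ k, |Qm r (n+1) k j - coefs j * x' n * (Qm r n k 2 + goldphi * Qm r n k 1)| ≤
          ∑ k, 20 * x n * ∑ m, Qm r n k m := by
        refine Finset.sum_le_sum fun k _ => ?_
        rw [Qm_row, hxd, hxd']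
        exact errU _ _ (fun m => Qm r n k m) (fun m => Qm_nonneg r n k m) j hj
      have e2 : ∑ k, 20 * x n * ∑ m, Qm r n k m = 20 * x n * ∑ m, cs r n m := by
        rw [← Finset.mul_sum]
        congr 1
        exact Finset.sum_comm
      rw [sv]
      have e3 : 20 * x n * ∑ m, cs r n m ≤ 20 * x n * (K * (cs r n 1 + cs r n 2)) :=
        mul_le_mul_of_nonneg_left H1 (by linarith)
      have e4 : x n ≤ (1/2) ^ n * x' n := by
        have := mul_le_mul_of_nonneg_left (hx n) hpn.le
        rwa [← mul_assoc, hpn2, one_mul] at this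
      have e5 : 20 * x n * (K * (cs r n 1 + cs r n 2)) ≤
          20 * ((1/2) ^ n * x' n) * (K * (cs r n 1 + cs r n 2)) := by gcongr
      have e6 : 1 / 2 * x' n * (cs r n 1 + cs r n 2) ≤
          coefs j * x' n * (cs r n 2 + goldphi * cs r n 1) := by
        have := (coefs_bounds j).1
        gcongr
      have e7 := mul_le_mul_of_nonneg_left e6 (by positivity : 0 ≤ 40 * K * (1/2:ℝ) ^ n)
      linarith
    have := vecAngle_sq_le _ _ (fun k => Qm r n k 2 + goldphi * Qm r n k 1)
      (coefs j * x' n) (coefs j' * x' n) _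
      (mul_pos (by linarith [(coefs_bounds j).1]) xp')
      (mul_pos (by linarith [(coefs_bounds j').1]) xp')
      (by rw [sv]; linarith) (main j hj) (main j' hj')
    refine this.trans (key _ ?_)
    have : 0 ≤ 2 * (K * D + 5) * (1/2:ℝ) ^ n := by positivity
    linarith
  · have sv : ∑ k, (Qm r n k 7 + goldphi * Qm r n k 8) = cs r n 7 + goldphi * cs r n 8 := by
      rw [Finset.sum_add_distrib, ← Finset.mul_sum]; rfl
    have svl : cs r n 7 + cs r n 8 ≤ cs r n 7 + goldphi * cs r n 8 := by nlinarith [nn n 8]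
    have main : ∀ j ∈ ({5,7,8} : Finset (Fin 9)),
        ∑ k, |Qm r (n+1) k j - coefs j * x n * (Qm r n k 7 + goldphi * Qm r n k 8)| ≤
        2 * (K * D + 5) * (1/2) ^ n *
          (coefs j * x n * ∑ k, (Qm r n k 7 + goldphi * Qm r n k 8)) := by
      intro j hj
      have e1 : ∑ k, |Qm r (n+1) k j - coefs j * x n * (Qm r n k 7 + goldphi * Qm r n k 8)| ≤
          ∑ k, ((Qm r n k 3 + Qm r n k 6) + 5 * (Qm r n k 7 + Qm r n k 8)) := by
        refine Finset.sum_le_sum fun k _ => ?_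
        rw [Qm_row, hxd]
        exact errW _ _ (fun m => Qm r n k m) (fun m => Qm_nonneg r n k m) j hj
      have e2 : ∑ k, ((Qm r n k 3 + Qm r n k 6) + 5 * (Qm r n k 7 + Qm r n k 8)) =
          (cs r n 3 + cs r n 6) + 5 * (cs r n 7 + cs r n 8) := by
        simp only [Finset.sum_add_distrib, ← Finset.mul_sum]; rfl
      rw [sv]
      have e3 : cs r n 3 + cs r n 6 ≤ K * (cs r n 1 + cs r n 2) := by
        refine le_trans ?_ H1
        rw [sum9]
        linarith [nn n 0, nn n 1, nn n 2, nn n 3, nn n 4, nn n 5, nn n 6, nn n 7, nn n 8]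
      have e3' := mul_le_mul_of_nonneg_left H2 hK.le
      have e4 : 1 ≤ (1/2) ^ n * x n := by
        have := mul_le_mul_of_nonneg_left (hx2 n) hpn.le
        rwa [hpn2] at this
      have e5 := mul_le_mul_of_nonneg_right e4 Wp.le
      have e6 : 1 / 2 * x n * (cs r n 7 + cs r n 8) ≤
          coefs j * x n * (cs r n 7 + goldphi * cs r n 8) := by
        have := (coefs_bounds j).1
        gcongr
      have e7 := mul_le_mul_of_nonneg_left e6
        (by positivity : 0 ≤ 2 * (K * D + 5) * (1/2:ℝ) ^ n)
      linarith
    have := vecAngle_sq_le _ _ (fun k => Qm r n k 7 + goldphi * Qm r n k 8)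
      (coefs j * x n) (coefs j' * x n) _
      (mul_pos (by linarith [(coefs_bounds j).1]) xp)
      (mul_pos (by linarith [(coefs_bounds j').1]) xp)
      (by rw [sv]; linarith) (main j hj) (main j' hj')
    refine this.trans (key _ ?_)
    have : 0 ≤ 40 * K * (1/2:ℝ) ^ n := by positivity
    linarith

/-- The angles between the columns of `Q_i = P_1 P_3 ⋯ P_{2i+1}` within each of the two
groups of indices {1,2,3,4,5,7} and {6,8,9} (here 0-indexed as {0,1,2,3,4,6} and {5,7,8})
decay at least exponentially in `i`. -/
theorem stmt10 (r : ℕ → ℕ) (hr : GoodSeq r) :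
    ∃ C : ℝ, 0 < C ∧ ∃ μ : ℝ, μ ∈ Set.Ioo (0 : ℝ) 1 ∧
      ∀ i : ℕ, 1 ≤ i → ∀ j j' : Fin 9,
        ((j ∈ ({0,1,2,3,4,6} : Finset (Fin 9)) ∧ j' ∈ ({0,1,2,3,4,6} : Finset (Fin 9))) ∨
         (j ∈ ({5,7,8} : Finset (Fin 9)) ∧ j' ∈ ({5,7,8} : Finset (Fin 9)))) →
        vecAngle
            (fun k => (((List.range (i+1)).map (fun l => Pmat r (2*l+1))).prod) k j)
            (fun k => (((List.range (i+1)).map (fun l => Pmat r (2*l+1))).prod) k j')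
          ≤ C * μ ^ i := by
  obtain ⟨N, D, hD, H⟩ := angle_sq_decay r hr
  obtain ⟨μ, hμ0, hμ1, hμ2⟩ : ∃ μ : ℝ, 0 < μ ∧ μ < 1 ∧ μ ^ 2 = 1 / 2 := by
    refine ⟨Real.sqrt (1/2), by positivity, ?_, Real.sq_sqrt (by norm_num)⟩
    rw [Real.sqrt_lt' (by norm_num)]; norm_num
  refine ⟨4 * (μ ^ N)⁻¹ + Real.sqrt D * μ⁻¹, by positivity, μ, ⟨hμ0, hμ1⟩, ?_⟩
  intro i hi j j' hjj
  change vecAngle (fun k => Qm r i k j) (fun k => Qm r i k j') ≤ _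
  rw [add_mul]
  have t1 : 0 ≤ 4 * (μ ^ N)⁻¹ * μ ^ i := by positivity
  have t2 : 0 ≤ Real.sqrt D * μ⁻¹ * μ ^ i := by positivity
  by_cases hN : i ≤ N
  · have h1 : vecAngle (fun k => Qm r i k j) (fun k => Qm r i k j') ≤ 4 :=
      (Real.arccos_le_pi _).trans Real.pi_le_four
    have h2 : μ ^ N ≤ μ ^ i := pow_le_pow_of_le_one hμ0.le hμ1.le hN
    have h3 : 1 ≤ (μ ^ N)⁻¹ * μ ^ i := by
      rw [inv_mul_eq_div, le_div_iff₀ (by positivity)]; linarith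
    linarith
  · obtain ⟨n, rfl⟩ : ∃ n, i = n + 1 := ⟨i - 1, by omega⟩
    have h := H n (by omega) j j' hjj
    have e : Real.sqrt D * μ⁻¹ * μ ^ (n+1) = Real.sqrt D * μ ^ n := by
      rw [pow_succ]; field_simp
    have h2 : vecAngle (fun k => Qm r (n+1) k j) (fun k => Qm r (n+1) k j') ≤
        Real.sqrt D * μ ^ n := by
      refine (abs_le_of_sq_le_sq' ?_ (by positivity)).2
      rw [mul_pow, Real.sq_sqrt hD.le, ← pow_mul, mul_comm n 2, pow_mul, hμ2]
      exact h
    linarith
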